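/- Uniform fourth-moment bound: in the exponential-family setup with ν having a log-concave density (so that every f(·;θ) is log-concave), suppose that ‖I_d − H_θ^{-1}J‖ < 1/2 in operator norm for every θ with ‖J(θ − θ_0)‖² ≤ cd/n, where H_θ is the symmetric square root of the covariance matrix of U ~ f(·;θ). Then B_{2n}(c) ≤ 2^{16}. -/

import Mathlib

open MeasureTheory ProbabilityTheory Filter Real Set
open scoped ENNReal RealInnerProductSpace BigOperators Topology

noncomputable section

/-- Euclidean space of dimension `d`. -/
abbrev EucSp (d : ℕ) := EuclideanSpace ℝ (Fin d)

/-- The log-normalizer `ψ(θ) = log ∫ e^{⟨x,θ⟩} dν(x)` of the exponential family. -/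
def psiFun {d : ℕ} (ν : Measure (EucSp d)) (θ : EucSp d) : ℝ :=
  Real.log (∫ x, Real.exp ⟪x, θ⟫ ∂ν)

/-- The exponential-family distribution with density `f(x;θ) = exp(⟨x,θ⟩ − ψ(θ))` w.r.t. `ν`. -/
def expMeas {d : ℕ} (ν : Measure (EucSp d)) (θ : EucSp d) : Measure (EucSp d) :=
  ν.withDensity fun x => ENNReal.ofReal (Real.exp (⟪x, θ⟫ - psiFun ν θ))

/-- The mean `E_θ[U]` of the exponential-family distribution. -/
def meanVec {d : ℕ} (ν : Measure (EucSp d)) (θ : EucSp d) : EucSp d :=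
  ∫ x, x ∂(expMeas ν θ)

/-- `B_{1n}(c)`: supremum of third absolute moments of `⟨a, V⟩`, `V = J⁻¹(U − E_θ U)`. -/
def B1 {d : ℕ} (ν : Measure (EucSp d)) (Θ : Set (EucSp d)) (θ₀ : EucSp d)
    (J Jinv : EucSp d →L[ℝ] EucSp d) (n : ℕ) (c : ℝ) : ℝ :=
  sSup {b | ∃ a θ, ‖a‖ = 1 ∧ θ ∈ Θ ∧ ‖J (θ - θ₀)‖ ^ 2 ≤ c * d / n ∧
    b = ∫ x, |⟪a, Jinv (x - meanVec ν θ)⟫| ^ 3 ∂(expMeas ν θ)}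

/-- `B_{2n}(c)`: supremum of fourth moments of `⟨a, V⟩`, `V = J⁻¹(U − E_θ U)`. -/
def B2 {d : ℕ} (ν : Measure (EucSp d)) (Θ : Set (EucSp d)) (θ₀ : EucSp d)
    (J Jinv : EucSp d →L[ℝ] EucSp d) (n : ℕ) (c : ℝ) : ℝ :=
  sSup {b | ∃ a θ, ‖a‖ = 1 ∧ θ ∈ Θ ∧ ‖J (θ - θ₀)‖ ^ 2 ≤ c * d / n ∧
    b = ∫ x, ⟪a, Jinv (x - meanVec ν θ)⟫ ^ 4 ∂(expMeas ν θ)}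


/-- A nonnegative function `h` is a log-concave density kernel if
`h(λx + (1−λ)y) ≥ h(x)^λ·h(y)^{1−λ}` for all `x, y` and `λ ∈ [0,1]`. -/
def IsLogConcaveFun {d : ℕ} (h : EucSp d → ℝ) : Prop :=
  (∀ x, 0 ≤ h x) ∧
    ∀ x y : EucSp d, ∀ t ∈ Set.Icc (0:ℝ) 1,
      h x ^ t * h y ^ (1 - t) ≤ h (t • x + (1 - t) • y)

/-- A measure on `ℝ^d` is log-concave if it has a log-concave density with respect to
Lebesgue measure. -/
def IsLogConcaveMeasure {d : ℕ} (μ : Measure (EucSp d)) : Prop :=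
  ∃ h : EucSp d → ℝ, IsLogConcaveFun h ∧
    μ = volume.withDensity fun x => ENNReal.ofReal (h x)

/-- Log-concavity of an extended nonnegative function on a real vector space. -/
def ENNLogConcave {E : Type*} [AddCommGroup E] [Module ℝ E] (f : E → ℝ≥0∞) : Prop :=
  ∀ x y : E, ∀ t ∈ Ioo (0 : ℝ) 1, f x ^ t * f y ^ (1 - t) ≤ f (t • x + (1 - t) • y)

namespace ENNLogConcave

variable {E : Type*} [AddCommGroup E] [Module ℝ E]

lemma convex_superlevel {f : E → ℝ≥0∞} (hf : ENNLogConcave f) (s : ℝ≥0∞) :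
    Convex ℝ {x | s < f x} := by
  rw [convex_iff_forall_pos]
  intro x hx y hy a b ha hb hab
  obtain rfl : b = 1 - a := by linarith
  refine lt_of_lt_of_le ?_ (hf x y a ⟨ha, by linarith⟩)
  calc s = s ^ a * s ^ (1 - a) := by
        rw [← ENNReal.rpow_add_of_nonneg _ _ ha.le hb.le]; simp
    _ < f x ^ a * f y ^ (1 - a) :=
        ENNReal.mul_lt_mul (ENNReal.rpow_lt_rpow hx ha) (ENNReal.rpow_lt_rpow hy hb)

lemma mul {f g : E → ℝ≥0∞} (hf : ENNLogConcave f) (hg : ENNLogConcave g) :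
    ENNLogConcave fun x => f x * g x := by
  intro x y t ht
  have h0 : 0 ≤ t := ht.1.le
  have h1 : 0 ≤ 1 - t := by linarith [ht.2]
  rw [ENNReal.mul_rpow_of_nonneg _ _ h0, ENNReal.mul_rpow_of_nonneg _ _ h1, mul_mul_mul_comm]
  exact mul_le_mul' (hf x y t ht) (hg x y t ht)

lemma comp_affine {F : Type*} [AddCommGroup F] [Module ℝ F] {f : E → ℝ≥0∞}
    (hf : ENNLogConcave f) {L : F → E}
    (hL : ∀ x y : F, ∀ t : ℝ, L (t • x + (1 - t) • y) = t • L x + (1 - t) • L y) :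
    ENNLogConcave fun x => f (L x) := by
  intro x y t ht
  simp only [hL]
  exact hf _ _ t ht

lemma indicator_one {C : Set E} (hC : Convex ℝ C) :
    ENNLogConcave (C.indicator fun _ => (1 : ℝ≥0∞)) := by
  intro x y t ht
  have h0 : 0 < t := ht.1
  have h1 : 0 < 1 - t := by linarith [ht.2]
  by_cases hx : x ∈ C
  · by_cases hy : y ∈ C
    · have := hC hx hy h0.le h1.le (by ring)
      simp [hx, hy, this]
    · simp [hy, h1]
  · simp [hx, h0]

end ENNLogConcave

lemma aemeasurable_of_convex_superlevel {E : Type*} [NormedAddCommGroup E] [NormedSpace ℝ E]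
    [FiniteDimensional ℝ E] [MeasurableSpace E] [BorelSpace E] (μ : Measure E)
    [μ.IsAddHaarMeasure] {f : E → ℝ≥0∞} (hf : ∀ s, Convex ℝ {x | s < f x}) :
    AEMeasurable f μ := by
  have h : NullMeasurable f μ :=
    measurable_of_Ioi (δ := NullMeasurableSpace E μ) fun s => (hf s).nullMeasurableSet μ
  exact h.aemeasurable

/-- One-dimensional Brunn-Minkowski inequality for nonempty convex sets. -/
lemma volume_combo_le_of_convex {A B C : Set ℝ} {t : ℝ} (ht : t ∈ Ioo (0 : ℝ) 1)
    (hA : A.Nonempty) (hB : B.Nonempty) (hC : Convex ℝ C)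
    (H : ∀ a ∈ A, ∀ b ∈ B, t * a + (1 - t) * b ∈ C) :
    ENNReal.ofReal t * volume A + ENNReal.ofReal (1 - t) * volume B ≤ volume C := by
  have h0 : 0 < t := ht.1
  have h1 : 0 < 1 - t := by linarith [ht.2]
  have key : ∀ p ∈ A ×ˢ A, ∀ q ∈ B ×ˢ B,
      ENNReal.ofReal t * edist p.1 p.2 + ENNReal.ofReal (1 - t) * edist q.1 q.2 ≤ volume C := by
    have aux : ∀ x ∈ A, ∀ y ∈ A, ∀ u ∈ B, ∀ v ∈ B, x ≤ y → u ≤ v →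
        ENNReal.ofReal t * edist x y + ENNReal.ofReal (1 - t) * edist u v ≤ volume C := by
      intro x hx y hy u hu v hv hxy huv
      have hsub : Icc (t * x + (1 - t) * u) (t * y + (1 - t) * v) ⊆ C :=
        hC.ordConnected.out (H x hx u hu) (H y hy v hv)
      refine le_trans (le_of_eq ?_) (measure_mono hsub)
      rw [Real.volume_Icc, edist_dist, edist_dist, Real.dist_eq, Real.dist_eq, abs_sub_comm x,
        abs_sub_comm u, abs_of_nonneg (by linarith), abs_of_nonneg (by linarith),
        ← ENNReal.ofReal_mul h0.le, ← ENNReal.ofReal_mul h1.le, ← ENNReal.ofReal_add]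
      · ring_nf
      · exact mul_nonneg h0.le (by linarith)
      · exact mul_nonneg h1.le (by linarith)
    rintro ⟨x, y⟩ ⟨hx, hy⟩ ⟨u, v⟩ ⟨hu, hv⟩
    rcases le_total x y with h | h <;> rcases le_total u v with h' | h'
    · exact aux x hx y hy u hu v hv h h'
    · simpa only [edist_comm u v] using aux x hx y hy v hv u hu h h'
    · simpa only [edist_comm x y] using aux y hy x hx u hu v hv h h'
    · simpa only [edist_comm x y, edist_comm u v] using aux y hy x hx v hv u hu h h'
  have hdiam : ∀ S : Set ℝ, volume S ≤ ⨆ p ∈ S ×ˢ S, edist p.1 p.2 := by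
    intro S
    refine (Real.volume_le_diam S).trans (Metric.ediam_le fun x hx y hy => ?_)
    exact le_iSup₂_of_le (x, y) ⟨hx, hy⟩ le_rfl
  calc ENNReal.ofReal t * volume A + ENNReal.ofReal (1 - t) * volume B
      ≤ ENNReal.ofReal t * (⨆ p ∈ A ×ˢ A, edist p.1 p.2)
        + ENNReal.ofReal (1 - t) * (⨆ p ∈ B ×ˢ B, edist p.1 p.2) := by
        gcongr <;> exact hdiam _
    _ ≤ volume C := by
        simp only [ENNReal.mul_iSup]
        exact ENNReal.biSup_add_biSup_le (hA.prod hA) (hB.prod hB) key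

lemma lintegral_min_one_eq_lintegral_meas_lt {α : Type*} [MeasurableSpace α] {μ : Measure α}
    {f : α → ℝ≥0∞} (hf : AEMeasurable f μ) :
    ∫⁻ x, min (f x) 1 ∂μ = ∫⁻ s in Ioo (0 : ℝ) 1, μ {x | ENNReal.ofReal s < f x} := by
  have hne : ∀ x, min (f x) 1 ≠ ∞ := fun x => ne_top_of_le_ne_top ENNReal.one_ne_top
    (min_le_right _ _)
  have hL := lintegral_eq_lintegral_meas_lt μ (f := fun x => (min (f x) 1).toReal)
    (Eventually.of_forall fun x => ENNReal.toReal_nonneg) (hf.min aemeasurable_const).ennreal_toReal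
  simp only [ENNReal.ofReal_toReal (hne _)] at hL
  rw [hL, ← lintegral_indicator measurableSet_Ioi, ← lintegral_indicator measurableSet_Ioo]
  refine lintegral_congr fun s => ?_
  by_cases hs : s ∈ Ioi (0 : ℝ)
  swap
  · rw [indicator_of_notMem hs, indicator_of_notMem fun h => hs h.1]
  rw [indicator_of_mem hs]
  by_cases hs' : s ∈ Ioo (0 : ℝ) 1
  · rw [indicator_of_mem hs']
    congr 1
    ext x
    simp only [mem_ofPred_eq]
    rw [← ENNReal.ofReal_lt_iff_lt_toReal hs'.1.le (hne x), lt_min_iff, and_iff_left]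
    simpa using hs'.2
  · rw [indicator_of_notMem hs']
    have h1 : 1 ≤ s := by
      by_contra h
      exact hs' ⟨hs, not_le.1 h⟩
    rw [measure_eq_zero_iff_ae_notMem]
    refine Eventually.of_forall fun x hx => ?_
    have : (min (f x) 1).toReal ≤ 1 := by
      simpa using ENNReal.toReal_mono ENNReal.one_ne_top (min_le_right (f x) 1)
    simp only [mem_ofPred_eq] at hx
    linarith

/-- The one-dimensional Prékopa-Leindler inequality in additive form, for quasi-concave functions
with supremum one. -/
lemma lintegral_combo_le_of_iSup_eq_one {f g h : ℝ → ℝ≥0∞} {t : ℝ} (ht : t ∈ Ioo (0 : ℝ) 1)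
    (hf : ∀ s, Convex ℝ {x | s < f x}) (hg : ∀ s, Convex ℝ {x | s < g x})
    (hh : ∀ s, Convex ℝ {x | s < h x}) (hf1 : ⨆ x, f x = 1) (hg1 : ⨆ x, g x = 1)
    (H : ∀ x y, f x ^ t * g y ^ (1 - t) ≤ h (t * x + (1 - t) * y)) :
    ENNReal.ofReal t * (∫⁻ x, f x) + ENNReal.ofReal (1 - t) * (∫⁻ x, g x) ≤ ∫⁻ x, h x := by
  have h0 : 0 < t := ht.1
  have h1 : 0 < 1 - t := by linarith [ht.2]
  have layer : ∀ u : ℝ → ℝ≥0∞, (∀ s, Convex ℝ {x | s < u x}) → ⨆ x, u x = 1 →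
      ∫⁻ x, u x = ∫⁻ s in Ioo (0 : ℝ) 1, volume {x | ENNReal.ofReal s < u x} := by
    intro u hu hu1
    rw [← lintegral_min_one_eq_lintegral_meas_lt (aemeasurable_of_convex_superlevel volume hu)]
    refine lintegral_congr fun x => ?_
    rw [min_eq_left]
    exact hu1 ▸ le_iSup u x
  have nonempty : ∀ u : ℝ → ℝ≥0∞, ⨆ x, u x = 1 → ∀ s ∈ Ioo (0 : ℝ) 1,
      {x | ENNReal.ofReal s < u x}.Nonempty := by
    intro u hu s hs
    have : ENNReal.ofReal s < ⨆ x, u x := by rw [hu]; simpa using hs.2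
    exact lt_iSup_iff.1 this
  rw [layer f hf hf1, layer g hg hg1, ← lintegral_const_mul' _ _ ENNReal.ofReal_ne_top,
    ← lintegral_const_mul' _ _ ENNReal.ofReal_ne_top]
  refine (le_lintegral_add _ _).trans ?_
  calc _ ≤ ∫⁻ s in Ioo (0 : ℝ) 1, volume {x | ENNReal.ofReal s < h x} := by
        refine setLIntegral_mono' measurableSet_Ioo fun s hs => ?_
        refine volume_combo_le_of_convex ht (nonempty f hf1 s hs) (nonempty g hg1 s hs) (hh _) ?_
        intro a ha b hb
        refine lt_of_lt_of_le ?_ (H a b)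
        calc ENNReal.ofReal s = ENNReal.ofReal s ^ t * ENNReal.ofReal s ^ (1 - t) := by
              rw [← ENNReal.rpow_add_of_nonneg _ _ h0.le h1.le]; simp
          _ < f a ^ t * g b ^ (1 - t) :=
              ENNReal.mul_lt_mul (ENNReal.rpow_lt_rpow ha h0) (ENNReal.rpow_lt_rpow hb h1)
    _ = ∫⁻ x, min (h x) 1 :=
        (lintegral_min_one_eq_lintegral_meas_lt (aemeasurable_of_convex_superlevel volume hh)).symm
    _ ≤ ∫⁻ x, h x := lintegral_mono fun x => min_le_left _ _

lemma ENNReal.rpow_mul_rpow_le_weighted_add {t : ℝ} (ht : t ∈ Ioo (0 : ℝ) 1) (a b : ℝ≥0∞) :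
    a ^ t * b ^ (1 - t) ≤ ENNReal.ofReal t * a + ENNReal.ofReal (1 - t) * b := by
  have h0 : 0 < t := ht.1
  have h1 : 0 < 1 - t := by linarith [ht.2]
  by_cases ha : a = ∞
  · simp [ha, ENNReal.mul_top, h0]
  by_cases hb : b = ∞
  · simp [hb, ENNReal.mul_top, ht.2]
  lift a to NNReal using ha
  lift b to NNReal using hb
  have := NNReal.geom_mean_le_arith_mean2_weighted t.toNNReal (1 - t).toNNReal a b
    (by rw [← Real.toNNReal_add h0.le h1.le]; simp)
  rw [Real.coe_toNNReal _ h0.le, Real.coe_toNNReal _ h1.le] at this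
  rw [← ENNReal.coe_rpow_of_nonneg _ h0.le, ← ENNReal.coe_rpow_of_nonneg _ h1.le]
  simp only [ENNReal.ofReal]
  exact_mod_cast this

lemma convex_superlevel_const_mul {E : Type*} [AddCommGroup E] [Module ℝ E] {f : E → ℝ≥0∞}
    (hf : ∀ s, Convex ℝ {x | s < f x}) {c : ℝ≥0∞} (hc : c ≠ 0) (hc' : c ≠ ∞) (s : ℝ≥0∞) :
    Convex ℝ {x | s < c * f x} := by
  convert hf (s / c) using 3 with x
  rw [ENNReal.div_lt_iff (Or.inl hc) (Or.inl hc'), mul_comm]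

/-- The one-dimensional Prékopa-Leindler inequality for bounded quasi-concave functions. -/
lemma lintegral_rpow_mul_le_of_bounded {f g h : ℝ → ℝ≥0∞} {t : ℝ} (ht : t ∈ Ioo (0 : ℝ) 1)
    (hf : ∀ s, Convex ℝ {x | s < f x}) (hg : ∀ s, Convex ℝ {x | s < g x})
    (hh : ∀ s, Convex ℝ {x | s < h x}) (hf1 : ⨆ x, f x ≠ ∞) (hg1 : ⨆ x, g x ≠ ∞)
    (H : ∀ x y, f x ^ t * g y ^ (1 - t) ≤ h (t * x + (1 - t) * y)) :
    (∫⁻ x, f x) ^ t * (∫⁻ x, g x) ^ (1 - t) ≤ ∫⁻ x, h x := by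
  have h0 : 0 < t := ht.1
  have h1 : 0 < 1 - t := by linarith [ht.2]
  set α := ⨆ x, f x with hα
  set β := ⨆ x, g x with hβ
  by_cases hα0 : α = 0
  · have : ∀ x, f x = 0 := by simpa [hα] using hα0
    simp [this, h0]
  by_cases hβ0 : β = 0
  · have : ∀ x, g x = 0 := by simpa [hβ] using hβ0
    simp [this, h1]
  have hA0 : α ^ t ≠ 0 := by simp [hα0, h0.le]
  have hA1 : α ^ t ≠ ∞ := ENNReal.rpow_ne_top_of_nonneg h0.le hf1
  have hB0 : β ^ (1 - t) ≠ 0 := by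
    rw [Ne, ENNReal.rpow_eq_zero_iff]; simp [hβ0, ht.2.le]
  have hB1 : β ^ (1 - t) ≠ ∞ := ENNReal.rpow_ne_top_of_nonneg h1.le hg1
  set K := α ^ t * β ^ (1 - t) with hK
  have hK0 : K ≠ 0 := mul_ne_zero hA0 hB0
  have hK1 : K ≠ ∞ := ENNReal.mul_ne_top hA1 hB1
  have hKinv : (α⁻¹) ^ t * (β⁻¹) ^ (1 - t) = K⁻¹ := by
    rw [hK, ENNReal.inv_rpow, ENNReal.inv_rpow, ENNReal.mul_inv (Or.inl hA0) (Or.inl hA1)]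
  have main := lintegral_combo_le_of_iSup_eq_one (f := fun x => α⁻¹ * f x)
    (g := fun x => β⁻¹ * g x) (h := fun x => K⁻¹ * h x) ht
    (convex_superlevel_const_mul hf (by simpa using hf1) (by simpa using hα0))
    (convex_superlevel_const_mul hg (by simpa using hg1) (by simpa using hβ0))
    (convex_superlevel_const_mul hh (by simpa using hK1) (by simpa using hK0))
    (by rw [← ENNReal.mul_iSup, ← hα, ENNReal.inv_mul_cancel hα0 hf1])
    (by rw [← ENNReal.mul_iSup, ← hβ, ENNReal.inv_mul_cancel hβ0 hg1])
    (by
      intro x y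
      rw [ENNReal.mul_rpow_of_nonneg _ _ h0.le, ENNReal.mul_rpow_of_nonneg _ _ h1.le,
        mul_mul_mul_comm, hKinv]
      gcongr
      exact H x y)
  have main' := (ENNReal.rpow_mul_rpow_le_weighted_add ht _ _).trans main
  rw [lintegral_const_mul' _ _ (by simpa using hα0), lintegral_const_mul' _ _ (by simpa using hβ0),
    lintegral_const_mul' _ _ (by simpa using hK0),
    ENNReal.mul_rpow_of_nonneg _ _ h0.le, ENNReal.mul_rpow_of_nonneg _ _ h1.le,
    mul_mul_mul_comm, hKinv] at main'
  exact (ENNReal.mul_le_mul_iff_right (by simpa using hK1) (by simpa using hK0)).1 main'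

/-- The one-dimensional Prékopa-Leindler inequality for quasi-concave functions. -/
lemma lintegral_rpow_mul_le {f g h : ℝ → ℝ≥0∞} {t : ℝ} (ht : t ∈ Ioo (0 : ℝ) 1)
    (hf : ∀ s, Convex ℝ {x | s < f x}) (hg : ∀ s, Convex ℝ {x | s < g x})
    (hh : ∀ s, Convex ℝ {x | s < h x})
    (H : ∀ x y, f x ^ t * g y ^ (1 - t) ≤ h (t * x + (1 - t) * y)) :
    (∫⁻ x, f x) ^ t * (∫⁻ x, g x) ^ (1 - t) ≤ ∫⁻ x, h x := by
  have h0 : 0 < t := ht.1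
  have h1 : 0 < 1 - t := by linarith [ht.2]
  by_cases hf0 : ∫⁻ x, f x = 0
  · simp [hf0, h0]
  by_cases hg0 : ∫⁻ x, g x = 0
  · simp [hg0, h1]
  have trunc : ∀ u : ℝ → ℝ≥0∞, (∀ s, Convex ℝ {x | s < u x}) → ∀ (N : ℕ) s,
      Convex ℝ {x | s < min (u x) N} := by
    intro u hu N s
    by_cases hs : s < N
    · simpa [hs] using hu s
    · simp [hs, convex_empty]
  have bdd : ∀ (u : ℝ → ℝ≥0∞) (N : ℕ), ⨆ x, min (u x) (N : ℝ≥0∞) ≠ ∞ := fun u N =>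
    ne_top_of_le_ne_top (ENNReal.natCast_ne_top N) (iSup_le fun x => min_le_right _ _)
  have lim : ∀ u : ℝ → ℝ≥0∞, (∀ s, Convex ℝ {x | s < u x}) →
      Tendsto (fun N : ℕ => ∫⁻ x, min (u x) N) atTop (𝓝 (∫⁻ x, u x)) := by
    intro u hu
    refine lintegral_tendsto_of_tendsto_of_monotone
      (fun N => aemeasurable_of_convex_superlevel volume (trunc u hu N)) ?_ ?_
    · exact Eventually.of_forall fun x N M hNM => min_le_min_left _ (by exact_mod_cast hNM)
    · refine Eventually.of_forall fun x => ?_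
      simpa using (tendsto_const_nhds (x := u x)).min ENNReal.tendsto_nat_nhds_top
  have hlim := ENNReal.Tendsto.mul
    (((ENNReal.continuous_rpow_const (y := t)).tendsto _).comp (lim f hf))
    (Or.inl (by rw [Ne, ENNReal.rpow_eq_zero_iff]; simp [hf0, h0.le]))
    (((ENNReal.continuous_rpow_const (y := 1 - t)).tendsto _).comp (lim g hg))
    (Or.inl (by rw [Ne, ENNReal.rpow_eq_zero_iff]; simp [hg0, ht.2.le]))
  refine le_of_tendsto' hlim fun N => ?_
  refine lintegral_rpow_mul_le_of_bounded ht (trunc f hf N) (trunc g hg N) hh (bdd f N) (bdd g N) ?_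
  intro x y
  refine le_trans ?_ (H x y)
  gcongr <;> exact min_le_left _ _

/-- Integrating out one real variable preserves log-concavity. -/
lemma ENNLogConcave.lintegral_real {E : Type*} [AddCommGroup E] [Module ℝ E] {f : E × ℝ → ℝ≥0∞}
    (hf : ENNLogConcave f) : ENNLogConcave fun x => ∫⁻ r, f (x, r) := by
  have slice : ∀ (x : E) s, Convex ℝ {r | s < f (x, r)} := fun x =>
    (hf.comp_affine (L := fun r : ℝ => (x, r)) fun r r' t => by
      ext
      · simp [← add_smul]
      · simp).convex_superlevel
  intro x y t ht
  refine lintegral_rpow_mul_le ht (slice x) (slice y) (slice _) fun r r' => ?_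
  exact hf (x, r) (y, r') t ht

/-- Integrating out finitely many real variables preserves log-concavity. -/
lemma ENNLogConcave.lintegral_pi {E : Type*} [AddCommGroup E] [Module ℝ E] :
    ∀ {n : ℕ} {f : E × (Fin n → ℝ) → ℝ≥0∞}, ENNLogConcave f →
      ENNLogConcave fun x => ∫⁻ z, f (x, z) := by
  intro n
  induction n with
  | zero =>
    intro f hf
    simp only [Measure.volume_pi_eq_dirac (0 : Fin 0 → ℝ), lintegral_dirac]
    exact hf.comp_affine (L := fun x => (x, (0 : Fin 0 → ℝ))) fun x y t => by simp
  | succ n ih =>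
    intro f hf
    have hg : ENNLogConcave fun p : (E × (Fin n → ℝ)) × ℝ =>
        f (p.1.1, (Fin.insertNth 0 p.2 p.1.2 : Fin (n + 1) → ℝ)) := by
      refine hf.comp_affine (L := fun p : (E × (Fin n → ℝ)) × ℝ =>
        (p.1.1, (Fin.insertNth 0 p.2 p.1.2 : Fin (n + 1) → ℝ))) fun p q t => ?_
      refine Prod.ext (by simp) ?_
      funext i
      refine Fin.cases ?_ (fun j => ?_) i <;> simp
    have := ih hg.lintegral_real
    convert this using 2 with x
    have hmeas : AEMeasurable (fun p : ℝ × (Fin n → ℝ) =>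
        f (x, (Fin.insertNth 0 p.1 p.2 : Fin (n + 1) → ℝ))) (volume.prod volume) := by
      refine aemeasurable_of_convex_superlevel _ (ENNLogConcave.convex_superlevel ?_)
      refine hf.comp_affine (L := fun p : ℝ × (Fin n → ℝ) =>
        (x, (Fin.insertNth 0 p.1 p.2 : Fin (n + 1) → ℝ))) fun p q t => ?_
      refine Prod.ext (by simp [← add_smul]) ?_
      funext i
      refine Fin.cases ?_ (fun j => ?_) i <;> simp
    have hmp := (volume_preserving_piFinSuccAbove (fun _ : Fin (n + 1) => ℝ) 0).symm
    rw [← hmp.lintegral_comp_emb (MeasurableEquiv.measurableEmbedding _)]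
    exact lintegral_prod_symm _ hmeas

/-- The upper tail of a linear functional under a log-concave measure is log-concave. -/
lemma tail_mul_tail_le_sq {d : ℕ} {D : EucSp d → ℝ≥0∞} (hD : ENNLogConcave D) (b m : EucSp d)
    (s h : ℝ) :
    volume.withDensity D {x | s - h < ⟪b, x - m⟫} * volume.withDensity D {x | s + h < ⟪b, x - m⟫}
      ≤ volume.withDensity D {x | s < ⟪b, x - m⟫} ^ 2 := by
  set C : Set (ℝ × EucSp d) := {p | p.1 < ⟪b, p.2 - m⟫} with hC
  have hCconv : Convex ℝ C := by
    intro p hp q hq t u ht hu htu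
    simp only [hC, mem_ofPred_eq, Prod.fst_add, Prod.smul_fst, Prod.snd_add, Prod.smul_snd,
      smul_eq_mul, inner_sub_right, inner_add_right, inner_smul_right] at hp hq ⊢
    obtain rfl : u = 1 - t := by linarith
    rcases ht.eq_or_lt with rfl | ht
    · simpa using hq
    · nlinarith [mul_lt_mul_of_pos_left hp ht, mul_le_mul_of_nonneg_left hq.le hu]
  have hF : ENNLogConcave fun p : ℝ × EucSp d => D p.2 * C.indicator (fun _ => 1) p :=
    (hD.comp_affine (L := fun p : ℝ × EucSp d => p.2) fun p q t => by simp).mul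
      (ENNLogConcave.indicator_one hCconv)
  have hG : ENNLogConcave fun p : ℝ × (Fin d → ℝ) =>
      D (WithLp.toLp 2 p.2) * C.indicator (fun _ => 1) (p.1, WithLp.toLp 2 p.2) :=
    hF.comp_affine (L := fun p : ℝ × (Fin d → ℝ) => (p.1, (WithLp.toLp 2 p.2 : EucSp d)))
      fun p q t => by ext <;> simp
  have hT := hG.lintegral_pi
  have htail : ∀ s : ℝ, volume.withDensity D {x | s < ⟪b, x - m⟫} =
      ∫⁻ z : Fin d → ℝ, D (WithLp.toLp 2 z) * C.indicator (fun _ => 1) (s, WithLp.toLp 2 z) := by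
    intro s
    have hms : MeasurableSet {x : EucSp d | s < ⟪b, x - m⟫} :=
      measurableSet_lt measurable_const (by fun_prop)
    rw [withDensity_apply _ hms, ← lintegral_indicator hms,
      ← (PiLp.volume_preserving_toLp (Fin d)).lintegral_comp_emb
        (MeasurableEquiv.toLp 2 (Fin d → ℝ)).measurableEmbedding]
    refine lintegral_congr fun z => ?_
    by_cases hz : s < ⟪b, WithLp.toLp 2 z - m⟫ <;> simp [hC, hz]
  have := hT (s - h) (s + h) (1 / 2) (by norm_num)
  have hmid : (1 / 2 : ℝ) • (s - h) + (1 - 1 / 2 : ℝ) • (s + h) = s := by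
    simp only [smul_eq_mul]; ring
  rw [hmid] at this
  simp only [← htail] at this
  have h2 := pow_le_pow_left' this 2
  rw [mul_pow, ← ENNReal.rpow_mul_natCast, ← ENNReal.rpow_mul_natCast] at h2
  norm_num at h2
  exact h2

section FourthMoment

variable {Ω : Type*} [MeasurableSpace Ω] {μ : Measure Ω}

lemma toReal_tail_le_geometric [IsProbabilityMeasure μ] {Z : Ω → ℝ} (hZ : Measurable Z)
    (hlc : ∀ s h, μ {x | s - h < Z x} * μ {x | s + h < Z x} ≤ μ {x | s < Z x} ^ 2)
    {r : ℝ} (hr : μ.real {x | r ≤ |Z x|} ≤ 1 / 9) (hr0 : 0 < r) (j : ℕ) :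
    μ.real {x | r * (1 + 2 * j) < Z x} ≤ 1 / 9 * (1 / 8) ^ j := by
  have hlcR : ∀ s h, μ.real {x | s - h < Z x} * μ.real {x | s + h < Z x}
      ≤ μ.real {x | s < Z x} ^ 2 := by
    intro s h
    have := ENNReal.toReal_mono (by finiteness) (hlc s h)
    simpa [ENNReal.toReal_mul, ENNReal.toReal_pow, Measure.real] using this
  have hlow : 8 / 9 ≤ μ.real {x | -r < Z x} := by
    have hc : μ.real {x | -r < Z x}ᶜ ≤ 1 / 9 := by
      refine (measureReal_mono ?_).trans hr
      intro x hx
      simp only [mem_compl_iff, mem_ofPred_eq, not_lt] at hx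
      exact le_abs.2 (Or.inr (le_neg.2 hx))
    rw [probReal_compl_eq_one_sub (measurableSet_lt measurable_const hZ)] at hc
    linarith
  have hbase : μ.real {x | r < Z x} ≤ 1 / 9 := by
    refine (measureReal_mono ?_).trans hr
    intro x hx
    exact le_abs.2 (Or.inl (show r < Z x from hx).le)
  have hstep : ∀ j : ℕ, μ.real {x | r * (1 + 2 * j) < Z x} ≤
      1 / 8 * μ.real {x | r * (2 * j - 1) < Z x} := by
    intro j
    induction j with
    | zero =>
      have e1 : r * (1 + 2 * ((0 : ℕ) : ℝ)) = r := by simp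
      have e2 : r * (2 * ((0 : ℕ) : ℝ) - 1) = -r := by simp
      rw [e1, e2]
      linarith
    | succ j ih =>
      have h1 := hlcR (r * (1 + 2 * j)) (2 * r)
      have e1 : r * (1 + 2 * j) - 2 * r = r * (2 * j - 1) := by ring
      have e2 : r * (1 + 2 * j) + 2 * r = r * (1 + 2 * ((j + 1 : ℕ) : ℝ)) := by push_cast; ring
      have e3 : r * (2 * ((j + 1 : ℕ) : ℝ) - 1) = r * (1 + 2 * j) := by push_cast; ring
      rw [e1, e2] at h1
      rw [e3]
      set p := μ.real {x | r * (2 * j - 1) < Z x}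
      set q := μ.real {x | r * (1 + 2 * j) < Z x} with hq
      set w := μ.real {x | r * (1 + 2 * ((j + 1 : ℕ) : ℝ)) < Z x}
      have hq0 : 0 ≤ q := measureReal_nonneg
      have hwq : w ≤ q := by
        refine measureReal_mono fun x hx => ?_
        simp only [mem_ofPred_eq] at hx ⊢
        push_cast at hx
        nlinarith
      rcases hq0.eq_or_lt with h0 | h0
      · rw [← h0] at hwq ⊢
        linarith
      · have hp : 0 < p := by linarith
        have : p * w ≤ p * (1 / 8 * q) := by nlinarith
        exact le_of_mul_le_mul_left this hp
  induction j with
  | zero => simpa using hbase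
  | succ j ih =>
    have := hstep (j + 1)
    have e3 : r * (2 * ((j + 1 : ℕ) : ℝ) - 1) = r * (1 + 2 * j) := by push_cast; ring
    rw [e3] at this
    rw [pow_succ]
    linarith

lemma sum_range_layer_le (N : ℕ) :
    ∑ j ∈ Finset.range N, ((6 * (3 + 2 * (j : ℝ))) ^ 4 - (6 * (1 + 2 * j)) ^ 4) * (1 / 8) ^ j
      ≤ 1296 * 190 := by
  have h : ∀ N : ℕ,
      ∑ j ∈ Finset.range N, ((6 * (3 + 2 * (j : ℝ))) ^ 4 - (6 * (1 + 2 * j)) ^ 4) * (1 / 8) ^ j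
        ≤ 1296 * (190 - (74 * ((N : ℝ) + 1) ^ 3 + 32 * ((N : ℝ) + 1) ^ 2 + 60 * ((N : ℝ) + 1) + 24) *
            (1 / 8) ^ N) := by
    intro N
    induction N with
    | zero => norm_num
    | succ N ih =>
      rw [Finset.sum_range_succ, pow_succ (1 / 8 : ℝ) N]
      push_cast
      have h8 : (0 : ℝ) < (1 / 8) ^ N := by positivity
      have hN : (0 : ℝ) ≤ N := N.cast_nonneg
      nlinarith [mul_nonneg h8.le hN, mul_nonneg h8.le (pow_nonneg hN 2),
        mul_nonneg h8.le (pow_nonneg hN 3)]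
  refine (h N).trans ?_
  have : (0 : ℝ) ≤ (74 * ((N : ℝ) + 1) ^ 3 + 32 * ((N : ℝ) + 1) ^ 2 + 60 * ((N : ℝ) + 1) + 24) *
       (1 / 8) ^ N := by positivity
  linarith

lemma ofReal_pow_four_le_layers (z : ℝ) :
    ENNReal.ofReal (z ^ 4) ≤ ENNReal.ofReal (6 ^ 4) + ∑' j : ℕ,
      ENNReal.ofReal ((6 * (3 + 2 * (j : ℝ))) ^ 4 - (6 * (1 + 2 * j)) ^ 4) *
        ((Ioi (6 * (1 + 2 * (j : ℝ)))).indicator (fun _ => 1) z +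
          (Ioi (6 * (1 + 2 * (j : ℝ)))).indicator (fun _ => 1) (-z)) := by
  have hex : ∃ N : ℕ, |z| ≤ 6 * (1 + 2 * (N : ℝ)) := by
    obtain ⟨N, hN⟩ := exists_nat_ge |z|
    exact ⟨N, by linarith [N.cast_nonneg (α := ℝ)]⟩
  classical
  set N := Nat.find hex with hNdef
  have hN : |z| ≤ 6 * (1 + 2 * (N : ℝ)) := Nat.find_spec hex
  have hlt : ∀ j < N, 6 * (1 + 2 * (j : ℝ)) < |z| := fun j hj => not_le.1 (Nat.find_min hex hj)
  have htel : ∑ j ∈ Finset.range N, ((6 * (3 + 2 * (j : ℝ))) ^ 4 - (6 * (1 + 2 * j)) ^ 4)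
      = (6 * (1 + 2 * (N : ℝ))) ^ 4 - 6 ^ 4 := by
    have := Finset.sum_range_sub (fun j : ℕ => (6 * (1 + 2 * (j : ℝ))) ^ 4) N
    simp only [Nat.cast_zero, mul_zero, add_zero, mul_one] at this
    rw [← this]
    refine Finset.sum_congr rfl fun j _ => ?_
    push_cast
    ring
  have hnn : ∀ j : ℕ, 0 ≤ (6 * (3 + 2 * (j : ℝ))) ^ 4 - (6 * (1 + 2 * (j : ℝ))) ^ 4 := by
    intro j
    rw [sub_nonneg]
    gcongr
    norm_num
  calc ENNReal.ofReal (z ^ 4) ≤ ENNReal.ofReal ((6 * (1 + 2 * (N : ℝ))) ^ 4) := by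
        refine ENNReal.ofReal_le_ofReal ?_
        rw [← (by decide : Even 4).pow_abs]
        gcongr
    _ = ENNReal.ofReal (6 ^ 4) + ∑ j ∈ Finset.range N,
          ENNReal.ofReal ((6 * (3 + 2 * (j : ℝ))) ^ 4 - (6 * (1 + 2 * j)) ^ 4) := by
        rw [← ENNReal.ofReal_sum_of_nonneg fun j _ => hnn j, htel, ← ENNReal.ofReal_add]
        · ring_nf
        · positivity
        · rw [← htel]; exact Finset.sum_nonneg fun j _ => hnn j
    _ ≤ _ := by
        gcongr
        refine le_trans (Finset.sum_le_sum fun j hj => ?_) (ENNReal.sum_le_tsum (Finset.range N))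
        refine le_mul_of_one_le_right' ?_
        rcases lt_abs.1 (hlt j (Finset.mem_range.1 hj)) with h | h
        · refine le_add_right ?_
          rw [indicator_of_mem (show z ∈ Ioi _ from h)]
        · refine le_add_left ?_
          rw [indicator_of_mem (show -z ∈ Ioi _ from h)]

lemma meas_abs_ge_le {Z : Ω → ℝ} (hZ : Measurable Z)
    (h2 : ∫⁻ x, ENNReal.ofReal (Z x ^ 2) ∂μ ≤ 4) {r : ℝ} (hr : 0 < r) :
    μ {x | r ≤ |Z x|} ≤ ENNReal.ofReal (4 / r ^ 2) := by
  have h := mul_meas_ge_le_lintegral (μ := μ) (f := fun x => ENNReal.ofReal (Z x ^ 2))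
    (by fun_prop) (ENNReal.ofReal (r ^ 2))
  have hset : {x | ENNReal.ofReal (r ^ 2) ≤ ENNReal.ofReal (Z x ^ 2)} = {x | r ≤ |Z x|} := by
    ext x
    simp only [mem_ofPred_eq]
    rw [ENNReal.ofReal_le_ofReal_iff (sq_nonneg _), sq_le_sq, abs_of_pos hr]
  rw [hset] at h
  rw [ENNReal.ofReal_div_of_pos (by positivity), ENNReal.le_div_iff_mul_le
    (Or.inl (by simp; positivity)) (Or.inl ENNReal.ofReal_ne_top), mul_comm]
  simpa using h.trans h2

/-- Fourth-moment bound for a random variable with log-concave tails and second moment at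
most four. -/
lemma lintegral_pow_four_le [IsProbabilityMeasure μ] {Z : Ω → ℝ} (hZ : Measurable Z)
    (hlc : ∀ s h, μ {x | s - h < Z x} * μ {x | s + h < Z x} ≤ μ {x | s < Z x} ^ 2)
    (hlc' : ∀ s h, μ {x | s - h < -Z x} * μ {x | s + h < -Z x} ≤ μ {x | s < -Z x} ^ 2)
    (h2 : ∫⁻ x, ENNReal.ofReal (Z x ^ 2) ∂μ ≤ 4) :
    ∫⁻ x, ENNReal.ofReal (Z x ^ 4) ∂μ ≤ 2 ^ 16 := by
  have h6 : μ.real {x | 6 ≤ |Z x|} ≤ 1 / 9 := by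
    refine ENNReal.toReal_le_of_le_ofReal (by norm_num) ?_
    convert meas_abs_ge_le hZ h2 (r := 6) (by norm_num) using 2
    norm_num
  have hnn : ∀ j : ℕ, 0 ≤ (6 * (3 + 2 * (j : ℝ))) ^ 4 - (6 * (1 + 2 * (j : ℝ))) ^ 4 := by
    intro j
    rw [sub_nonneg]
    gcongr
    norm_num
  have tail : ∀ {W : Ω → ℝ}, Measurable W → (∀ x, |W x| = |Z x|) →
      (∀ s h, μ {x | s - h < W x} * μ {x | s + h < W x} ≤ μ {x | s < W x} ^ 2) → ∀ j : ℕ,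
      ∫⁻ x, (Ioi (6 * (1 + 2 * (j : ℝ)))).indicator (fun _ => (1 : ℝ≥0∞)) (W x) ∂μ
        ≤ ENNReal.ofReal (1 / 9 * (1 / 8) ^ j) := by
    intro W hW habs hWlc j
    have : ∫⁻ x, (Ioi (6 * (1 + 2 * (j : ℝ)))).indicator (fun _ => (1 : ℝ≥0∞)) (W x) ∂μ
        = μ {x | 6 * (1 + 2 * (j : ℝ)) < W x} := by
      rw [← lintegral_indicator_one (measurableSet_lt measurable_const hW)]
      rfl
    rw [this, ← ofReal_measureReal]
    exact ENNReal.ofReal_le_ofReal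
      (toReal_tail_le_geometric hW hWlc (by simpa only [habs] using h6) (by norm_num) j)
  have hind : ∀ {W : Ω → ℝ}, Measurable W → ∀ j : ℕ, Measurable fun x =>
      (Ioi (6 * (1 + 2 * (j : ℝ)))).indicator (fun _ => (1 : ℝ≥0∞)) (W x) := fun hW j =>
    (measurable_const.indicator measurableSet_Ioi).comp hW
  have hsum : ∀ j : ℕ, Measurable fun x =>
      (Ioi (6 * (1 + 2 * (j : ℝ)))).indicator (fun _ => (1 : ℝ≥0∞)) (Z x) +
        (Ioi (6 * (1 + 2 * (j : ℝ)))).indicator (fun _ => 1) (-Z x) := fun j =>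
    (hind hZ j).add (hind hZ.neg j)
  calc ∫⁻ x, ENNReal.ofReal (Z x ^ 4) ∂μ
      ≤ ∫⁻ x, (ENNReal.ofReal (6 ^ 4) + ∑' j : ℕ,
        ENNReal.ofReal ((6 * (3 + 2 * (j : ℝ))) ^ 4 - (6 * (1 + 2 * j)) ^ 4) *
          ((Ioi (6 * (1 + 2 * (j : ℝ)))).indicator (fun _ => 1) (Z x) +
            (Ioi (6 * (1 + 2 * (j : ℝ)))).indicator (fun _ => 1) (-Z x))) ∂μ :=
        lintegral_mono fun x => ofReal_pow_four_le_layers (Z x)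
    _ ≤ ENNReal.ofReal (6 ^ 4) + ∑' j : ℕ,
        ENNReal.ofReal ((6 * (3 + 2 * (j : ℝ))) ^ 4 - (6 * (1 + 2 * j)) ^ 4) *
          (ENNReal.ofReal (1 / 9 * (1 / 8) ^ j) + ENNReal.ofReal (1 / 9 * (1 / 8) ^ j)) := by
        rw [lintegral_add_left measurable_const, lintegral_const, measure_univ, mul_one,
          lintegral_tsum fun j => ((hsum j).const_mul _).aemeasurable]
        gcongr with j
        rw [lintegral_const_mul _ (hsum j),
          lintegral_add_left (hind hZ j)]
        gcongr
        · exact tail hZ (fun x => rfl) hlc j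
        · exact tail hZ.neg (fun x => abs_neg _) hlc' j
    _ ≤ ENNReal.ofReal (6 ^ 4) + ENNReal.ofReal (2 / 9 * (1296 * 190)) := by
        gcongr
        refine ENNReal.tsum_le_of_sum_range_le fun N => ?_
        have : ∀ j : ℕ, ENNReal.ofReal ((6 * (3 + 2 * (j : ℝ))) ^ 4 - (6 * (1 + 2 * j)) ^ 4) *
            (ENNReal.ofReal (1 / 9 * (1 / 8) ^ j) + ENNReal.ofReal (1 / 9 * (1 / 8) ^ j)) =
            ENNReal.ofReal (2 / 9 *
              (((6 * (3 + 2 * (j : ℝ))) ^ 4 - (6 * (1 + 2 * j)) ^ 4) * (1 / 8) ^ j)) := by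
          intro j
          rw [← ENNReal.ofReal_add (by positivity) (by positivity),
            ← ENNReal.ofReal_mul (hnn j)]
          ring_nf
        simp only [this]
        rw [← ENNReal.ofReal_sum_of_nonneg fun j _ =>
          mul_nonneg (by norm_num) (mul_nonneg (hnn j) (by positivity)), ← Finset.mul_sum]
        exact ENNReal.ofReal_le_ofReal
          (mul_le_mul_of_nonneg_left (sum_range_layer_le N) (by norm_num))
    _ ≤ 2 ^ 16 := by
        rw [← ENNReal.ofReal_add (by norm_num) (by norm_num)]
        exact ENNReal.ofReal_le_of_le_toReal (by norm_num)

lemma meas_pos_eq_zero_of_infinite (hμ : μ univ = ∞) {Z : Ω → ℝ} (hZ : Measurable Z)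
    (hlc : ∀ s h, μ {x | s - h < Z x} * μ {x | s + h < Z x} ≤ μ {x | s < Z x} ^ 2)
    (h2 : ∫⁻ x, ENNReal.ofReal (Z x ^ 2) ∂μ ≤ 4) : μ {x | 0 < Z x} = 0 := by
  have key : ∀ r : ℝ, 0 < r → μ {x | 3 * r < Z x} = 0 := by
    intro r hr
    have hfin : μ {x | r ≤ |Z x|} < ∞ :=
      (meas_abs_ge_le hZ h2 hr).trans_lt ENNReal.ofReal_lt_top
    have htop : μ {x | -r < Z x} = ∞ := by
      by_contra hne
      have hsub : (univ : Set Ω) ⊆ {x | -r < Z x} ∪ {x | r ≤ |Z x|} := by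
        intro x _
        by_cases hx : -r < Z x
        · exact Or.inl hx
        · exact Or.inr (le_abs.2 (Or.inr (le_neg.2 (not_lt.1 hx))))
      have := (measure_mono (μ := μ) hsub).trans (measure_union_le _ _)
      rw [hμ, top_le_iff, ENNReal.add_eq_top] at this
      exact this.elim hne hfin.ne
    have hr' : μ {x | r < Z x} ≠ ∞ := by
      refine ne_top_of_le_ne_top hfin.ne (measure_mono fun x hx => ?_)
      exact le_abs.2 (Or.inl (show r < Z x from hx).le)
    have h := hlc r (2 * r)
    rw [show r - 2 * r = -r by ring, show r + 2 * r = 3 * r by ring, htop] at h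
    by_contra hne
    rw [ENNReal.top_mul hne, top_le_iff] at h
    exact ENNReal.pow_ne_top hr' h
  have hU : {x | 0 < Z x} ⊆ ⋃ n : ℕ, {x | 3 * (1 / ((n : ℝ) + 1)) < Z x} := by
    intro x hx
    obtain ⟨n, hn⟩ := exists_nat_one_div_lt (show 0 < Z x / 3 by simpa using hx)
    exact mem_iUnion.2 ⟨n, by simp only [mem_ofPred_eq]; linarith⟩
  exact measure_mono_null hU (measure_iUnion_null fun n => key _ (by positivity))

lemma lintegral_pow_four_eq_zero_of_infinite (hμ : μ univ = ∞) {Z : Ω → ℝ} (hZ : Measurable Z)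
    (hlc : ∀ s h, μ {x | s - h < Z x} * μ {x | s + h < Z x} ≤ μ {x | s < Z x} ^ 2)
    (hlc' : ∀ s h, μ {x | s - h < -Z x} * μ {x | s + h < -Z x} ≤ μ {x | s < -Z x} ^ 2)
    (h2 : ∫⁻ x, ENNReal.ofReal (Z x ^ 2) ∂μ ≤ 4) :
    ∫⁻ x, ENNReal.ofReal (Z x ^ 4) ∂μ = 0 := by
  have hp := meas_pos_eq_zero_of_infinite hμ hZ hlc h2
  have hn := meas_pos_eq_zero_of_infinite hμ hZ.neg hlc' (by simpa using h2)
  rw [lintegral_eq_zero_iff (by fun_prop)]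
  filter_upwards [measure_eq_zero_iff_ae_notMem.1 hp, measure_eq_zero_iff_ae_notMem.1 hn]
    with x hx hx'
  simp only [not_lt, Pi.neg_apply] at hx hx'
  have : Z x = 0 := by linarith
  simp [this]

end FourthMoment

lemma IsLogConcaveFun.ennLogConcave_ofReal {d : ℕ} {h : EucSp d → ℝ} (hh : IsLogConcaveFun h) :
    ENNLogConcave fun x => ENNReal.ofReal (h x) := by
  intro x y t ht
  have h0 : 0 ≤ t := ht.1.le
  have h1 : 0 ≤ 1 - t := by linarith [ht.2]
  rw [ENNReal.ofReal_rpow_of_nonneg (hh.1 x) h0, ENNReal.ofReal_rpow_of_nonneg (hh.1 y) h1,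
    ← ENNReal.ofReal_mul (Real.rpow_nonneg (hh.1 x) t)]
  exact ENNReal.ofReal_le_ofReal (hh.2 x y t ⟨h0, ht.2.le⟩)

lemma ennLogConcave_exp_inner {d : ℕ} (θ : EucSp d) (p : ℝ) :
    ENNLogConcave fun x : EucSp d => ENNReal.ofReal (Real.exp (⟪x, θ⟫ - p)) := by
  refine IsLogConcaveFun.ennLogConcave_ofReal ⟨fun x => (Real.exp_pos _).le, fun x y t _ => ?_⟩
  simp only
  rw [← Real.exp_mul, ← Real.exp_mul, ← Real.exp_add, inner_add_left, inner_smul_left,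
    inner_smul_left]
  refine le_of_eq (congrArg Real.exp ?_)
  simp only [conj_trivial]
  ring

/-- A member of an exponential family over a log-concave base measure has a log-concave density. -/
lemma exists_expMeas_eq_withDensity {d : ℕ} {ν : Measure (EucSp d)} (hν : IsLogConcaveMeasure ν)
    (θ : EucSp d) : ∃ D, ENNLogConcave D ∧ expMeas ν θ = volume.withDensity D := by
  obtain ⟨h₀, hh, rfl⟩ := hν
  refine ⟨_, hh.ennLogConcave_ofReal.mul (ennLogConcave_exp_inner θ
    (psiFun (volume.withDensity fun x => ENNReal.ofReal (h₀ x)) θ)), ?_⟩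
  have hm := aemeasurable_of_convex_superlevel (volume : Measure (EucSp d))
    hh.ennLogConcave_ofReal.convex_superlevel
  have hm' := aemeasurable_of_convex_superlevel (volume : Measure (EucSp d))
    (ennLogConcave_exp_inner θ
      (psiFun (volume.withDensity fun x => ENNReal.ofReal (h₀ x)) θ)).convex_superlevel
  exact (withDensity_mul₀ hm hm').symm

lemma expMeas_univ {d : ℕ} (ν : Measure (EucSp d)) (θ : EucSp d) :
    expMeas ν θ univ = 0 ∨ expMeas ν θ univ = 1 ∨ expMeas ν θ univ = ∞ := by
  set L := ∫⁻ x, ENNReal.ofReal (Real.exp ⟪x, θ⟫) ∂ν with hL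
  have hmass : expMeas ν θ univ = ENNReal.ofReal (Real.exp (-psiFun ν θ)) * L := by
    rw [expMeas, withDensity_apply _ MeasurableSet.univ, setLIntegral_univ,
      ← lintegral_const_mul' _ _ ENNReal.ofReal_ne_top]
    refine lintegral_congr fun x => ?_
    rw [← ENNReal.ofReal_mul (Real.exp_pos _).le, ← Real.exp_add]
    ring_nf
  have hint : ∫ x, Real.exp ⟪x, θ⟫ ∂ν = L.toReal :=
    integral_eq_lintegral_of_nonneg_ae (Eventually.of_forall fun x => (Real.exp_pos _).le)
      (Continuous.aestronglyMeasurable (by fun_prop))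
  rw [hmass]
  by_cases h0 : L = 0
  · simp [h0]
  by_cases h1 : L = ∞
  · right; right
    rw [h1, ENNReal.mul_top]
    simp [Real.exp_pos]
  · right; left
    have hpos : 0 < L.toReal := ENNReal.toReal_pos h0 h1
    rw [psiFun, hint, Real.exp_neg, Real.exp_log hpos, ENNReal.ofReal_inv_of_pos hpos,
      ENNReal.ofReal_toReal h1, ENNReal.inv_mul_cancel h0 h1]

/-- A linear functional under an exponential family over a log-concave base measure has fourth
moment at most `2 ^ 16` as soon as its second moment is at most four. -/
lemma integral_inner_pow_four_le {d : ℕ} {ν : Measure (EucSp d)} (hν : IsLogConcaveMeasure ν)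
    (θ b m : EucSp d) (hint : Integrable (fun x => ⟪b, x - m⟫ ^ 2) (expMeas ν θ))
    (h2 : ∫ x, ⟪b, x - m⟫ ^ 2 ∂(expMeas ν θ) ≤ 4) :
    ∫ x, ⟪b, x - m⟫ ^ 4 ∂(expMeas ν θ) ≤ 2 ^ 16 := by
  have hZ : Measurable fun x : EucSp d => ⟪b, x - m⟫ := by fun_prop
  have hlc : ∀ s h, expMeas ν θ {x | s - h < ⟪b, x - m⟫} * expMeas ν θ {x | s + h < ⟪b, x - m⟫}
      ≤ expMeas ν θ {x | s < ⟪b, x - m⟫} ^ 2 := by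
    obtain ⟨D, hD, hDeq⟩ := exists_expMeas_eq_withDensity hν θ
    rw [hDeq]
    exact tail_mul_tail_le_sq hD b m
  have hlc' : ∀ s h, expMeas ν θ {x | s - h < -⟪b, x - m⟫} *
      expMeas ν θ {x | s + h < -⟪b, x - m⟫} ≤ expMeas ν θ {x | s < -⟪b, x - m⟫} ^ 2 := by
    obtain ⟨D, hD, hDeq⟩ := exists_expMeas_eq_withDensity hν θ
    rw [hDeq]
    simpa only [inner_neg_left] using tail_mul_tail_le_sq hD (-b) m
  have h2' : ∫⁻ x, ENNReal.ofReal (⟪b, x - m⟫ ^ 2) ∂(expMeas ν θ) ≤ 4 := by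
    rw [← ofReal_integral_eq_lintegral_ofReal hint (Eventually.of_forall fun x => sq_nonneg _)]
    exact ENNReal.ofReal_le_of_le_toReal (by simpa using h2)
  rw [integral_eq_lintegral_of_nonneg_ae
    (Eventually.of_forall fun x => (by decide : Even 4).pow_nonneg _)
    (Continuous.aestronglyMeasurable (by fun_prop))]
  refine ENNReal.toReal_le_of_le_ofReal (by norm_num) ?_
  have hgoal : ∫⁻ x, ENNReal.ofReal (⟪b, x - m⟫ ^ 4) ∂(expMeas ν θ) ≤ 2 ^ 16 := by
    rcases expMeas_univ ν θ with h | h | h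
    · rw [Measure.measure_univ_eq_zero.1 h]
      simp
    · have : IsProbabilityMeasure (expMeas ν θ) := ⟨h⟩
      exact lintegral_pow_four_le hZ hlc hlc' h2'
    · rw [lintegral_pow_four_eq_zero_of_infinite h hZ hlc hlc' h2']
      exact zero_le
  exact hgoal.trans_eq (by norm_num)

lemma norm_comp_inv_le_two {F : Type*} [NormedAddCommGroup F] [InnerProductSpace ℝ F]
    {J Jinv H Hinv : F →L[ℝ] F} (hJ : ∀ x y : F, ⟪Jinv x, y⟫ = ⟪x, Jinv y⟫)
    (hH : ∀ x y : F, ⟪H x, y⟫ = ⟪x, H y⟫) (hJJ : ∀ x, J (Jinv x) = x) (hHH : ∀ x, Hinv (H x) = x)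
    (hnear : ‖ContinuousLinearMap.id ℝ F - Hinv.comp J‖ < 1 / 2) {a : F} (ha : ‖a‖ = 1) :
    ‖H (Jinv a)‖ ≤ 2 := by
  set w := H (Jinv a) with hw
  set y := Jinv (H w) with hy
  have hTy : Hinv (J y) = w := by rw [hy, hJJ, hHH]
  have hyw : ‖y - w‖ ≤ 1 / 2 * ‖y‖ := by
    have := (ContinuousLinearMap.id ℝ F - Hinv.comp J).le_of_opNorm_le hnear.le y
    simpa [hTy] using this
  have hy2 : ‖y‖ ≤ 2 * ‖w‖ := by
    have := norm_sub_norm_le y w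
    linarith
  have hin : ‖w‖ ^ 2 = ⟪y, a⟫ := by
    rw [← real_inner_self_eq_norm_sq, hy, hJ, hw, ← hH]
  have := real_inner_le_norm y a
  rw [ha, mul_one, ← hin] at this
  rcases (norm_nonneg w).eq_or_lt with h | h
  · rw [← h]; norm_num
  · nlinarith

/-- **Theorem (Statement 14).** Uniform fourth-moment bound: in an exponential family
whose dominating measure `ν` has a log-concave density (so every `f(·;θ)` is log-concave),
if `‖I − H_θ⁻¹J‖ < 1/2` for every `θ` with `‖J(θ − θ₀)‖² ≤ cd/n`, where `H_θ` is the
symmetric square root of the covariance of `U ~ f(·;θ)`, then `B_{2n}(c) ≤ 2^16`. -/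
theorem uniform_fourth_moment_bound {d n : ℕ}
    (ν : Measure (EucSp d))
    -- ν has a log-concave density with respect to Lebesgue measure
    (hν : ∃ h₀ : EucSp d → ℝ, IsLogConcaveFun h₀ ∧
      ν = volume.withDensity fun x => ENNReal.ofReal (h₀ x))
    (Θ : Set (EucSp d)) (θ₀ : EucSp d) (hθ₀ : θ₀ ∈ Θ)
    -- J = F^{1/2} is the symmetric square root of the Fisher information at θ₀,
    -- with inverse J⁻¹
    (J Jinv : EucSp d →L[ℝ] EucSp d)
    (hJsymm : ∀ x y : EucSp d, ⟪J x, y⟫ = ⟪x, J y⟫)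
    (hJsq : ∀ x : EucSp d, J (J x) = fderiv ℝ (gradient (psiFun ν)) θ₀ x)
    (hJinv : ∀ x : EucSp d, J (Jinv x) = x ∧ Jinv (J x) = x)
    (c : ℝ) (hc : 0 < c)
    -- H_θ: the symmetric square root of the covariance matrix of U ~ f(·;θ),
    -- with inverse Hinv_θ, for θ in the relevant neighborhood of θ₀
    (Hθ Hθinv : EucSp d → EucSp d →L[ℝ] EucSp d)
    (hH : ∀ θ ∈ Θ, ‖J (θ - θ₀)‖ ^ 2 ≤ c * d / n →
      (∀ x y : EucSp d, ⟪Hθ θ x, y⟫ = ⟪x, Hθ θ y⟫) ∧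
      (∀ a b : EucSp d, ⟪a, Hθ θ (Hθ θ b)⟫ =
        ∫ x, ⟪a, x - meanVec ν θ⟫ * ⟪b, x - meanVec ν θ⟫ ∂(expMeas ν θ)) ∧
      (∀ x : EucSp d, Hθ θ (Hθinv θ x) = x ∧ Hθinv θ (Hθ θ x) = x))
    -- the closeness condition ‖I − H_θ⁻¹J‖ < 1/2 on the neighborhood
    (hnear : ∀ θ ∈ Θ, ‖J (θ - θ₀)‖ ^ 2 ≤ c * d / n →
      ‖ContinuousLinearMap.id ℝ (EucSp d) - (Hθinv θ).comp J‖ < 1 / 2) :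
    B2 ν Θ θ₀ J Jinv n c ≤ 2 ^ 16 := by
  refine Real.sSup_le ?_ (by norm_num)
  rintro _ ⟨a, θ, ha, hθ, hnb, rfl⟩
  obtain ⟨hHsymm, hHcov, hHinv⟩ := hH θ hθ hnb
  have hJs : ∀ x y : EucSp d, ⟪Jinv x, y⟫ = ⟪x, Jinv y⟫ := fun x y => by
    rw [← (hJinv y).1, ← hJsymm, (hJinv x).1, (hJinv y).1]
  have hnorm := norm_comp_inv_le_two hJs hHsymm (fun x => (hJinv x).1) (fun x => (hHinv x).2)
    (hnear θ hθ hnb) ha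
  set b := Jinv a with hb
  simp only [← hJs, ← hb]
  have hcov : ‖Hθ θ b‖ ^ 2 = ∫ x, ⟪b, x - meanVec ν θ⟫ ^ 2 ∂(expMeas ν θ) := by
    rw [← real_inner_self_eq_norm_sq, hHsymm, hHcov]
    simp only [pow_two]
  refine integral_inner_pow_four_le hν θ b _ ?_ (by rw [← hcov]; nlinarith [norm_nonneg (Hθ θ b)])
  by_contra hni
  rw [integral_undef hni, sq_eq_zero_iff, norm_eq_zero] at hcov
  have hb0 : b = 0 := by rw [← (hHinv b).2, hcov, map_zero]
  have ha0 : a = 0 := by rw [← (hJinv a).1, ← hb, hb0, map_zero]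
  simp [ha0] at ha
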